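/- If M is an N × N uniformly random matrix with ±1 entries, then the probability that the sign spiky rank of M is at least N/(12 log₂ N) is at least 1 − 2^{−N²/2}. -/

import Mathlib

open Matrix MeasureTheory

/-- A blocky matrix: its support is a disjoint union of combinatorial rectangles,
with value 1 on the support and 0 elsewhere. -/
def IsBlocky {F : Type*} [Field F] {m n : Type*} (M : Matrix m n F) : Prop :=
  ∃ (k : ℕ) (S : Fin k → Finset m) (T : Fin k → Finset n),
    (∀ a b, a ≠ b → Disjoint (S a) (S b)) ∧
    (∀ a b, a ≠ b → Disjoint (T a) (T b)) ∧
    (∀ i j, (∃ l, i ∈ S l ∧ j ∈ T l) → M i j = 1) ∧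
    (∀ i j, (¬ ∃ l, i ∈ S l ∧ j ∈ T l) → M i j = 0)

/-- A spiky matrix: the entrywise product of a blocky matrix and a rank-one matrix. -/
def IsSpiky {F : Type*} [Field F] {m n : Type*} (M : Matrix m n F) : Prop :=
  ∃ (B : Matrix m n F) (u : m → F) (v : n → F),
    IsBlocky B ∧ ∀ i j, M i j = B i j * (u i * v j)

/-- The spiky rank: minimum number of spiky matrices summing to `M`. -/
noncomputable def spikyRank {F : Type*} [Field F] {m n : Type*} (M : Matrix m n F) : ℕ :=
  sInf {r | ∃ f : Fin r → Matrix m n F, (∀ i, IsSpiky (f i)) ∧ ∑ i, f i = M}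

/-- The blocky rank: minimum number of blocky matrices whose linear combination equals `M`. -/
noncomputable def blockyRank {F : Type*} [Field F] {m n : Type*} (M : Matrix m n F) : ℕ :=
  sInf {r | ∃ (f : Fin r → Matrix m n F) (c : Fin r → F),
    (∀ i, IsBlocky (f i)) ∧ ∑ i, c i • f i = M}

/-- Sparsity: the number of nonzero entries of a matrix. -/
noncomputable def matSparsity {F : Type*} [Zero F] {m n : Type*} (M : Matrix m n F) : ℕ :=
  {p : m × n | M p.1 p.2 ≠ 0}.ncard

/-- Rank-`r` rigidity: minimum number of entries that must be changed to bring the rank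
down to `r`. -/
noncomputable def rigidity {F : Type*} [Field F] {N : ℕ}
    (M : Matrix (Fin N) (Fin N) F) (r : ℕ) : ℕ :=
  sInf {s | ∃ A C : Matrix (Fin N) (Fin N) F, M = A + C ∧ A.rank ≤ r ∧ matSparsity C ≤ s}

/-- Sign spiky rank: minimum spiky rank over real matrices with the same sign pattern. -/
noncomputable def signSpikyRank {m n : Type*} (M : Matrix m n ℝ) : ℕ :=
  sInf {r | ∃ A : Matrix m n ℝ,
    (∀ i j, Real.sign (A i j) = Real.sign (M i j)) ∧ spikyRank A ≤ r}

/-- Blocky cover number: minimum number of blocky matrices whose supports' union is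
exactly the set of 1-entries of the Boolean matrix `M`. -/
noncomputable def blockyCover {m n : Type*} (M : Matrix m n ℝ) : ℕ :=
  sInf {k | ∃ f : Fin k → Matrix m n ℝ, (∀ l, IsBlocky (f l)) ∧
    ∀ i j, M i j = 1 ↔ ∃ l, f l i j = 1}

/-- A system `X i ^ D = q i` with `deg (q i) < D` has at most `D ^ n` solutions in `n` variables. -/
theorem MvPolynomial.card_le_of_pow_eq_eval {K σ : Type*} [Field K] [Fintype σ] {D : ℕ}
    (q : σ → MvPolynomial σ K) (hq : ∀ i, (q i).totalDegree < D) (Z : Finset (σ → K))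
    (hZ : ∀ z ∈ Z, ∀ i, z i ^ D = MvPolynomial.eval z (q i)) :
    Z.card ≤ D ^ Fintype.card σ := by
  classical
  let ev : MvPolynomial σ K →ₗ[K] (Z → K) :=
    LinearMap.pi fun z => (MvPolynomial.aeval (R := K) z.1).toLinearMap
  have hev : ∀ p z, ev p z = MvPolynomial.eval z.1 p := fun p z => by
    simp [ev, MvPolynomial.aeval_eq_eval]
  let b : (σ → Fin D) → (Z → K) := fun e z => ∏ i, z.1 i ^ (e i : ℕ)
  have hmem : ∀ n, ∀ p : MvPolynomial σ K, p.totalDegree ≤ n →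
      ev p ∈ Submodule.span K (Set.range b) := by
    intro n
    induction n using Nat.strong_induction_on with
    | _ n ih =>
      intro p hp
      rw [p.as_sum, map_sum]
      refine Submodule.sum_mem _ fun s hs => ?_
      have hsn : (s.sum fun _ e => e) ≤ n := (MvPolynomial.le_totalDegree hs).trans hp
      by_cases h : ∀ i, s i < D
      · have : ev (MvPolynomial.monomial s (p.coeff s)) =
            p.coeff s • b fun i => ⟨s i, h i⟩ := by
          ext z
          simp [hev, b, MvPolynomial.eval_monomial, Finsupp.prod_fintype]
        rw [this]
        exact Submodule.smul_mem _ _ (Submodule.subset_span ⟨_, rfl⟩)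
      · push Not at h
        obtain ⟨i, hi⟩ := h
        have hle : Finsupp.single i D ≤ s := by simpa using hi
        obtain ⟨t, rfl⟩ := exists_add_of_le hle
        have : ev (MvPolynomial.monomial (Finsupp.single i D + t)
              (p.coeff (Finsupp.single i D + t))) =
            ev (MvPolynomial.monomial t (p.coeff (Finsupp.single i D + t)) * q i) := by
          ext z
          rw [hev, hev, map_mul, ← hZ z.1 z.2 i, add_comm, MvPolynomial.monomial_add_single]
          simp
        rw [this]
        have hdeg : D + (t.sum fun _ e => e) ≤ n := by
          rw [Finsupp.sum_add_index' (by simp) (by simp)] at hsn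
          simpa using hsn
        have h1 := MvPolynomial.totalDegree_mul
          (MvPolynomial.monomial t (p.coeff (Finsupp.single i D + t))) (q i)
        have h2 := MvPolynomial.totalDegree_monomial_le t (p.coeff (Finsupp.single i D + t))
        have h3 := hq i
        refine ih _ ?_ _ le_rfl
        have : (t.sum fun _ => id) = t.sum fun _ e => e := rfl
        omega
  have hsurj : ∀ z : Z, ∃ p, ev p = Pi.single z 1 := by
    intro z
    have : ∀ y : Z, ∃ p : MvPolynomial σ K, MvPolynomial.eval z.1 p = 1 ∧
        (y ≠ z → MvPolynomial.eval y.1 p = 0) := by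
      intro y
      by_cases h : y = z
      · exact ⟨1, by simp [h]⟩
      · obtain ⟨i, hi⟩ := Function.ne_iff.1 (fun h' => h (Subtype.ext h'))
        refine ⟨.C (z.1 i - y.1 i)⁻¹ * (.X i - .C (y.1 i)), ?_, ?_⟩
        · simpa using inv_mul_cancel₀ (sub_ne_zero.2 (Ne.symm hi))
        · simp
    choose p hp1 hp2 using this
    refine ⟨∏ y, p y, ?_⟩
    ext y
    rw [hev, map_prod]
    by_cases h : y = z
    · subst h
      simp [hp1]
    · rw [Pi.single_eq_of_ne h]
      exact Finset.prod_eq_zero (Finset.mem_univ y) (hp2 y h)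
  have htop : Submodule.span K (Set.range b) = ⊤ := by
    rw [eq_top_iff, ← (Pi.basisFun K Z).span_eq, Submodule.span_le]
    rintro _ ⟨z, rfl⟩
    obtain ⟨p, hp⟩ := hsurj z
    simpa [← hp] using hmem _ p le_rfl
  have := finrank_range_le_card (R := K) b
  rw [Set.finrank, htop, finrank_top] at this
  simpa using this

theorem MvPolynomial.totalDegree_pderiv_le {R σ : Type*} [CommSemiring R]
    (p : MvPolynomial σ R) (i : σ) : (pderiv i p).totalDegree ≤ p.totalDegree := by
  classical
  conv_lhs => rw [p.as_sum, map_sum]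
  refine totalDegree_finsetSum_le fun s hs => ?_
  rw [pderiv_monomial]
  refine (totalDegree_monomial_le _ _).trans (le_trans ?_ (le_totalDegree hs))
  show (s - Finsupp.single i 1).degree ≤ s.degree
  exact Finsupp.degree_mono tsub_le_self

theorem MvPolynomial.hasDerivAt_eval_update {σ : Type*} [DecidableEq σ] (p : MvPolynomial σ ℝ)
    (x : σ → ℝ) (i : σ) (t : ℝ) :
    HasDerivAt (fun t => eval (Function.update x i t) p)
      (eval (Function.update x i t) (pderiv i p)) t := by
  induction p using MvPolynomial.induction_on with
  | C a => simpa using hasDerivAt_const t a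
  | add p q hp hq => simpa using hp.fun_add hq
  | mul_X p j hp =>
    by_cases h : j = i
    · subst h
      simpa [pderiv_mul, add_comm, mul_comm] using hp.fun_mul (hasDerivAt_id t)
    · simpa [pderiv_mul, h, pderiv_X_of_ne h, mul_comm] using hp.mul_const (x j)

theorem MvPolynomial.eval_pderiv_eq_zero_of_isLocalMax {σ : Type*} (p : MvPolynomial σ ℝ)
    {x : σ → ℝ} (h : IsLocalMax (fun y => eval y p) x) (i : σ) : eval x (pderiv i p) = 0 := by
  classical
  have hd := p.hasDerivAt_eval_update x i (x i)
  rw [Function.update_eq_self] at hd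
  refine IsLocalMax.hasDerivAt_eq_zero ?_ hd
  have hc : ContinuousAt (fun t => Function.update x i t) (x i) :=
    (continuous_const.update i continuous_id).continuousAt
  have ht := hc.tendsto
  rw [Function.update_eq_self] at ht
  simpa [IsLocalMax, IsMaxFilter] using ht.eventually h

theorem MvPolynomial.exists_abs_eval_le {σ : Type*} [Fintype σ] (p : MvPolynomial σ ℝ) :
    ∃ C : ℝ, ∀ x : σ → ℝ, 1 ≤ ‖x‖ → |eval x p| ≤ C * ‖x‖ ^ p.totalDegree := by
  refine ⟨∑ s ∈ p.support, |p.coeff s|, fun x hx => ?_⟩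
  rw [eval_eq, Finset.sum_mul]
  refine (Finset.abs_sum_le_sum_abs _ _).trans (Finset.sum_le_sum fun s hs => ?_)
  rw [abs_mul]
  refine mul_le_mul_of_nonneg_left ?_ (abs_nonneg _)
  rw [Finset.abs_prod]
  calc ∏ i ∈ s.support, |x i ^ s i| ≤ ∏ i ∈ s.support, ‖x‖ ^ s i := by
        refine Finset.prod_le_prod (fun _ _ => abs_nonneg _) fun i _ => ?_
        rw [abs_pow]
        exact pow_le_pow_left₀ (abs_nonneg _) (norm_le_pi_norm x i) _
    _ = ‖x‖ ^ (s.sum fun _ e => e) := by rw [Finset.prod_pow_eq_pow_sum]; rfl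
    _ ≤ _ := pow_le_pow_right₀ hx (le_totalDegree hs)

/-- A coercive perturbation of a polynomial attains its maximum on a closed set. -/
theorem MvPolynomial.exists_isMaxOn_sub_sum_pow {σ : Type*} [Fintype σ] (p : MvPolynomial σ ℝ)
    {K : ℕ} (hK : p.totalDegree < 2 * K) {ε : ℝ} (hε : 0 < ε) {s : Set (σ → ℝ)} (hs : IsClosed s)
    {x : σ → ℝ} (hxs : x ∈ s) (hx : 0 < eval x (p - C ε * ∑ i, X i ^ (2 * K))) :
    ∃ y ∈ s, IsMaxOn (fun z => eval z (p - C ε * ∑ i, X i ^ (2 * K))) s y := by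
  obtain ⟨C', hC⟩ := p.exists_abs_eval_le
  set G : (σ → ℝ) → ℝ := fun z => eval z (p - C ε * ∑ i, X i ^ (2 * K)) with hG
  set R : ℝ := max 1 (C' / ε) with hR
  have hout : ∀ z : σ → ℝ, R < ‖z‖ → G z ≤ 0 := by
    intro z hz
    have h1 : 1 < ‖z‖ := (le_max_left _ _).trans_lt hz
    have h2 : C' ≤ ε * ‖z‖ := by
      have := ((le_max_right _ _).trans_lt hz).le
      rwa [div_le_iff₀' hε] at this
    have h3 : ‖z‖ ^ (2 * K) ≤ ∑ i, z i ^ (2 * K) := by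
      have hne : Nonempty σ := by
        by_contra hne
        rw [not_nonempty_iff] at hne
        have : ‖z‖ = 0 := by rw [Subsingleton.elim z 0, norm_zero]
        linarith
      obtain ⟨i, hi⟩ := Finite.exists_max fun i => ‖z i‖
      have hn : ‖z‖ ≤ ‖z i‖ := (pi_norm_le_iff_of_nonneg (norm_nonneg _)).2 hi
      calc ‖z‖ ^ (2 * K) ≤ ‖z i‖ ^ (2 * K) := pow_le_pow_left₀ (norm_nonneg _) hn _
        _ = z i ^ (2 * K) := by rw [Real.norm_eq_abs, pow_mul, pow_mul, sq_abs]
        _ ≤ _ := Finset.single_le_sum (f := fun i => z i ^ (2 * K))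
            (fun j _ => by rw [pow_mul]; positivity) (Finset.mem_univ i)
    have h4 := (le_abs_self _).trans (hC z h1.le)
    have h5 : C' * ‖z‖ ^ p.totalDegree ≤ ε * ‖z‖ ^ (2 * K) :=
      calc C' * ‖z‖ ^ p.totalDegree ≤ ε * ‖z‖ * ‖z‖ ^ p.totalDegree := by gcongr
        _ = ε * ‖z‖ ^ (p.totalDegree + 1) := by ring
        _ ≤ _ := mul_le_mul_of_nonneg_left (pow_le_pow_right₀ h1.le hK) hε.le
    have h6 := mul_le_mul_of_nonneg_left h3 hε.le
    simp only [hG, map_sub, map_mul, map_sum, map_pow, eval_C, eval_X]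
    linarith
  have hin : ∀ z : σ → ℝ, 0 < G z → z ∈ Metric.closedBall 0 R := by
    intro z hz
    rw [mem_closedBall_zero_iff]
    by_contra h
    exact (hout z (not_le.1 h)).not_gt hz
  have hcomp : IsCompact (s ∩ Metric.closedBall 0 R) :=
    (isCompact_closedBall _ _).inter_left hs
  obtain ⟨y, hy, hmax⟩ := hcomp.exists_isMaxOn ⟨x, hxs, hin x hx⟩
    (MvPolynomial.continuous_eval (p - C ε * ∑ i, X i ^ (2 * K))).continuousOn
  refine ⟨y, hy.1, fun z hz => ?_⟩
  rcases lt_or_ge 0 (G z) with h | h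
  · exact hmax ⟨hz, hin z h⟩
  · exact h.trans (hx.le.trans (hmax ⟨hxs, hin x hx⟩))

/-- Sign patterns realised on the region where the product of the polynomials has a fixed sign. -/
theorem MvPolynomial.card_signPatterns_le_of_prod {σ ι : Type*} [Fintype σ] [Fintype ι]
    (f : ι → MvPolynomial σ ℝ) {K : ℕ} (hK : ∑ i, (f i).totalDegree + 1 < 2 * K) (c : ℝ)
    (S : Finset (ι → Bool))
    (hS : ∀ s ∈ S, ∃ x, (∀ i, 0 < (if s i then 1 else -1) * eval x (f i)) ∧
      0 < c * eval x (∏ i, f i)) :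
    S.card ≤ (2 * K - 1) ^ Fintype.card σ := by
  classical
  set Q : MvPolynomial σ ℝ := C c * ∏ i, f i with hQ
  have hQdeg : Q.totalDegree ≤ ∑ i, (f i).totalDegree := by
    refine (totalDegree_mul _ _).trans ?_
    rw [totalDegree_C, zero_add]
    exact totalDegree_finsetProd _ _
  choose! x hx1 hx2 using hS
  obtain ⟨ε, hε, hεS⟩ : ∃ ε : ℝ, 0 < ε ∧
      ∀ s ∈ S, 0 < eval (x s) (Q - C ε * ∑ i, X i ^ (2 * K)) := by
    have hev : ∀ᶠ ε : ℝ in nhdsWithin 0 (Set.Ioi 0),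
        ∀ s ∈ S, 0 < eval (x s) (Q - C ε * ∑ i, X i ^ (2 * K)) := by
      rw [Filter.eventually_all_finset]
      intro s hs
      refine nhdsWithin_le_nhds ?_
      have hcont : Continuous fun ε : ℝ => eval (x s) (Q - C ε * ∑ i, X i ^ (2 * K)) := by
        simp only [map_sub, map_mul, eval_C]
        fun_prop
      refine hcont.continuousAt.eventually (lt_mem_nhds ?_)
      simpa [hQ] using hx2 s hs
    obtain ⟨ε, h1, h2⟩ := (hev.and self_mem_nhdsWithin).exists
    exact ⟨ε, h2, h1⟩
  set H : MvPolynomial σ ℝ := Q - C ε * ∑ i, X i ^ (2 * K) with hH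
  have hcrit : ∀ s ∈ S, ∃ y : σ → ℝ, (∀ i, 0 < (if s i then 1 else -1) * eval y (f i)) ∧
      ∀ i, eval y (pderiv i H) = 0 := by
    intro s hs
    have hcl : IsClosed {z : σ → ℝ | ∀ i, 0 ≤ (if s i then 1 else -1) * eval z (f i)} := by
      rw [Set.ofPred_forall]
      exact isClosed_iInter fun i => isClosed_le continuous_const
        (continuous_const.mul (continuous_eval _))
    obtain ⟨y, hy, hmax⟩ := Q.exists_isMaxOn_sub_sum_pow (K := K) (by omega) hε hcl
      (fun i => (hx1 s hs i).le) (hεS s hs)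
    have hHy : 0 < eval y H := (hεS s hs).trans_le (hmax fun i => (hx1 s hs i).le)
    have hQy : eval y Q ≠ 0 := by
      have h0 : 0 ≤ ε * ∑ i, y i ^ (2 * K) := by
        refine mul_nonneg hε.le (Finset.sum_nonneg fun i _ => ?_)
        rw [pow_mul]
        positivity
      simp only [hH, map_sub, map_mul, map_sum, map_pow, eval_C, eval_X] at hHy
      exact (h0.trans_lt (sub_pos.1 hHy)).ne'
    have hfy : ∀ i, 0 < (if s i then 1 else -1) * eval y (f i) := by
      intro i
      refine lt_of_le_of_ne (hy i) (Ne.symm (mul_ne_zero (by split_ifs <;> norm_num) ?_))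
      intro h0
      apply hQy
      rw [hQ, map_mul, map_prod, Finset.prod_eq_zero (Finset.mem_univ i) h0, mul_zero]
    refine ⟨y, hfy, H.eval_pderiv_eq_zero_of_isLocalMax (hmax.isLocalMax ?_)⟩
    have : ∀ᶠ z in nhds y, ∀ i, 0 < (if s i then 1 else -1) * eval z (f i) := by
      rw [Filter.eventually_all]
      intro i
      exact (continuous_const.mul (continuous_eval _)).continuousAt.eventually
        (lt_mem_nhds (hfy i))
    exact this.mono fun z hz i => (hz i).le
  choose! y hy1 hy2 using hcrit
  have hinj : Set.InjOn y S := by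
    intro s hs t ht hst
    funext i
    have h1 := hy1 s hs i
    have h2 := hy1 t ht i
    rw [hst] at h1
    revert h1 h2
    cases s i <;> cases t i <;> simp <;> intro h1 <;> linarith
  rw [← Finset.card_image_of_injOn hinj]
  have hKpos : (0 : ℝ) < 2 * K := by exact_mod_cast (by omega : 0 < 2 * K)
  refine card_le_of_pow_eq_eval (fun i => C (ε * (2 * K))⁻¹ * pderiv i Q) (fun i => ?_) _ ?_
  · refine (totalDegree_mul _ _).trans_lt ?_
    rw [totalDegree_C, zero_add]
    have := Q.totalDegree_pderiv_le i
    omega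
  · intro z hz i
    obtain ⟨s, hs, rfl⟩ := Finset.mem_image.1 hz
    have h := hy2 s hs i
    have hsum : pderiv i (∑ j, X j ^ (2 * K) : MvPolynomial σ ℝ) =
        C (2 * K : ℝ) * X i ^ (2 * K - 1) := by
      rw [map_sum, Finset.sum_eq_single i]
      · simpa using Or.inl (map_ofNat C 2).symm
      · intro j _ hj
        simp [pderiv_X_of_ne hj]
      · simp
    rw [hH, map_sub, pderiv_C_mul (f := ∑ j, X j ^ (2 * K)), hsum] at h
    simp only [map_sub, map_mul, map_pow, eval_C, eval_X] at h
    simp only [map_mul, eval_C]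
    rw [eq_inv_mul_iff_mul_eq₀ (by positivity)]
    linarith

/-- A Warren-type bound on the number of sign patterns realised by a family of real polynomials. -/
theorem MvPolynomial.ncard_signPatterns_le {σ ι : Type*} [Fintype σ] [Fintype ι]
    (f : ι → MvPolynomial σ ℝ) {K : ℕ} (hK : ∑ i, (f i).totalDegree + 1 < 2 * K) :
    {s : ι → Bool | ∃ x, ∀ i, 0 < (if s i then 1 else -1) * eval x (f i)}.ncard ≤
      2 * (2 * K - 1) ^ Fintype.card σ := by
  classical
  let T : ℝ → Set (ι → Bool) := fun c =>
    {s | ∃ x, (∀ i, 0 < (if s i then 1 else -1) * eval x (f i)) ∧ 0 < c * eval x (∏ i, f i)}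
  have hT : ∀ c, (T c).ncard ≤ (2 * K - 1) ^ Fintype.card σ := by
    intro c
    rw [Set.ncard_eq_toFinset_card']
    exact card_signPatterns_le_of_prod f hK c _ fun s hs => by simpa [T] using hs
  have hsub : {s : ι → Bool | ∃ x, ∀ i, 0 < (if s i then 1 else -1) * eval x (f i)} ⊆
      T 1 ∪ T (-1) := by
    rintro s ⟨x, hx⟩
    have hne : eval x (∏ i, f i) ≠ 0 := by
      rw [map_prod]
      exact Finset.prod_ne_zero_iff.2 fun i _ => right_ne_zero_of_mul (hx i).ne'
    rcases hne.lt_or_gt with h | h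
    · exact Or.inr ⟨x, hx, by linarith⟩
    · exact Or.inl ⟨x, hx, by linarith⟩
  calc _ ≤ (T 1 ∪ T (-1)).ncard := Set.ncard_le_ncard hsub (Set.toFinite _)
    _ ≤ (T 1).ncard + (T (-1)).ncard := Set.ncard_union_le _ _
    _ ≤ _ := by linarith [hT 1, hT (-1)]

/-- The combinatorial data of a normalised spiky matrix: a set of representative rows, one for each
block, and an assignment of blocks to the other rows and to the columns. -/
abbrev SpikyShape (m n : Type*) : Type _ :=
  (R : Finset m) × ({i // i ∉ R} → Option R) × (n → Option R)

namespace SpikyShape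

variable {m n : Type*} [DecidableEq m]

/-- The block of a row, named by its representative. -/
def rowLabel (p : SpikyShape m n) (i : m) : Option p.1 :=
  if h : i ∈ p.1 then some ⟨i, h⟩ else p.2.1 ⟨i, h⟩

/-- The free parameters of a spiky matrix of a given shape. -/
abbrev Var (p : SpikyShape m n) : Type _ := {i // i ∉ p.1} ⊕ n

open Classical in
/-- The entries of a spiky matrix of a given shape, as polynomials in its free parameters. -/
noncomputable def entry (p : SpikyShape m n) (i : m) (j : n) : MvPolynomial p.Var ℝ :=
  if ∃ ρ, p.rowLabel i = some ρ ∧ p.2.2 j = some ρ then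
    (if h : i ∈ p.1 then 1 else .X (.inl ⟨i, h⟩)) * .X (.inr j)
  else 0

theorem totalDegree_entry_le (p : SpikyShape m n) (i : m) (j : n) :
    (p.entry i j).totalDegree ≤ 2 := by
  unfold entry
  split_ifs with h1 h2
  · simp
  · exact (MvPolynomial.totalDegree_mul _ _).trans (by simp)
  · simp

theorem exists_eq_eval_entry {A : Matrix m n ℝ} (hA : IsSpiky A) :
    ∃ (p : SpikyShape m n) (x : p.Var → ℝ), ∀ i j, A i j = MvPolynomial.eval x (p.entry i j) := by
  classical
  obtain ⟨B, u, v, ⟨k, S, T, hS, hT, hB1, hB0⟩, hA⟩ := hA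
  have hSeq : ∀ {a b i}, i ∈ S a → i ∈ S b → a = b := fun {a b i} ha hb => by
    by_contra h
    exact Finset.disjoint_left.1 (hS a b h) ha hb
  have hTeq : ∀ {a b j}, j ∈ T a → j ∈ T b → a = b := fun {a b j} ha hb => by
    by_contra h
    exact Finset.disjoint_left.1 (hT a b h) ha hb
  choose g hgS hgu using fun l : {l // ∃ i ∈ S l, u i ≠ 0} => l.2
  let R : Finset m := Finset.univ.image g
  have hgR : ∀ l, g l ∈ R := fun l => Finset.mem_image_of_mem g (Finset.mem_univ l)
  have hRu : ∀ ρ : R, u ρ ≠ 0 := by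
    rintro ⟨ρ, hρ⟩
    obtain ⟨l, -, rfl⟩ := Finset.mem_image.1 hρ
    exact hgu l
  have hrow : ∀ i, ∃ a : Option R, ∀ ρ, a = some ρ ↔ ∃ l, i ∈ S l.1 ∧ u i ≠ 0 ∧ g l = ρ := by
    intro i
    by_cases h : ∃ l : {l // ∃ i ∈ S l, u i ≠ 0}, i ∈ S l.1 ∧ u i ≠ 0
    · obtain ⟨l, hl, hu⟩ := h
      refine ⟨some ⟨g l, hgR l⟩, fun ρ => ⟨?_, ?_⟩⟩
      · rintro ⟨⟩
        exact ⟨l, hl, hu, rfl⟩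
      · rintro ⟨l', hl', -, h⟩
        obtain rfl : l = l' := Subtype.ext (hSeq hl hl')
        simp [h]
    · refine ⟨none, fun ρ => ⟨fun h' => by simp at h', ?_⟩⟩
      rintro ⟨l, hl, hu, -⟩
      exact (h ⟨l, hl, hu⟩).elim
  have hcol : ∀ j, ∃ b : Option R, ∀ ρ, b = some ρ ↔ ∃ l, j ∈ T l.1 ∧ g l = ρ := by
    intro j
    by_cases h : ∃ l : {l // ∃ i ∈ S l, u i ≠ 0}, j ∈ T l.1
    · obtain ⟨l, hl⟩ := h
      refine ⟨some ⟨g l, hgR l⟩, fun ρ => ⟨?_, ?_⟩⟩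
      · rintro ⟨⟩
        exact ⟨l, hl, rfl⟩
      · rintro ⟨l', hl', h⟩
        obtain rfl : l = l' := Subtype.ext (hTeq hl hl')
        simp [h]
    · refine ⟨none, fun ρ => ⟨fun h' => by simp at h', ?_⟩⟩
      rintro ⟨l, hl, -⟩
      exact (h ⟨l, hl⟩).elim
  choose a ha using hrow
  choose b hb using hcol
  let p : SpikyShape m n := ⟨R, fun i => a i, b⟩
  have hp : ∀ i, p.rowLabel i = a i := by
    intro i
    unfold rowLabel
    split_ifs with h
    · obtain ⟨l, -, hl⟩ := Finset.mem_image.1 h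
      refine ((ha i ⟨i, h⟩).2 ⟨l, ?_, ?_, hl⟩).symm
      · exact hl ▸ hgS l
      · exact hl ▸ hgu l
    · rfl
  refine ⟨p, Sum.elim (fun i => u i / (a i).elim 0 (fun ρ => u ρ))
    (fun j => v j * (b j).elim 0 (fun ρ => u ρ)), fun i j => ?_⟩
  rw [hA]
  unfold entry
  simp only [hp]
  split_ifs with h hi
  · obtain ⟨ρ, h1, h2⟩ := h
    obtain ⟨l, hil, -, hl⟩ := (ha i ρ).1 h1
    obtain ⟨l', hjl, hl'⟩ := (hb j ρ).1 h2
    obtain rfl : l = l' := Subtype.ext (hSeq (hgS l) (by rw [hl, ← hl']; exact hgS l'))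
    have hρ : a i = some ⟨i, hi⟩ := (hp i).symm.trans (dif_pos hi)
    have hiρ : ρ = ⟨i, hi⟩ := Option.some_injective _ (h1.symm.trans hρ)
    rw [hB1 i j ⟨l, hil, hjl⟩]
    replace h2 : b j = some ρ := h2
    simp [h2, hiρ]
    ring
  · obtain ⟨ρ, h1, h2⟩ := h
    obtain ⟨l, hil, -, hl⟩ := (ha i ρ).1 h1
    obtain ⟨l', hjl, hl'⟩ := (hb j ρ).1 h2
    obtain rfl : l = l' := Subtype.ext (hSeq (hgS l) (by rw [hl, ← hl']; exact hgS l'))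
    have := hRu ρ
    rw [hB1 i j ⟨l, hil, hjl⟩]
    replace h2 : b j = some ρ := h2
    simp [h1, h2]
    field_simp
  · rw [map_zero]
    by_cases hu : u i = 0
    · simp [hu]
    · rw [hB0 i j, zero_mul]
      rintro ⟨l, hil, hjl⟩
      let l' : {l // ∃ i ∈ S l, u i ≠ 0} := ⟨l, i, hil, hu⟩
      exact h ⟨⟨g l', hgR l'⟩, (ha i _).2 ⟨l', hil, hu, rfl⟩, (hb j _).2 ⟨l', hjl, rfl⟩⟩

end SpikyShape

theorem exists_isSpiky_sum_eq {m n : Type*} [Fintype m] [Fintype n] (A : Matrix m n ℝ) :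
    ∃ f : Fin (spikyRank A) → Matrix m n ℝ, (∀ i, IsSpiky (f i)) ∧ ∑ i, f i = A := by
  classical
  refine Nat.sInf_mem (s := {r | ∃ f : Fin r → Matrix m n ℝ, (∀ i, IsSpiky (f i)) ∧ ∑ i, f i = A})
    ⟨Fintype.card m, fun t => Matrix.of fun i j => if (Fintype.equivFin m).symm t = i then A i j else 0,
      ?_, ?_⟩
  · intro t
    generalize hi₀ : (Fintype.equivFin m).symm t = i₀
    refine ⟨fun i _ => if i₀ = i then 1 else 0, fun _ => 1, A i₀,
      ⟨1, fun _ => {i₀}, fun _ => Finset.univ, ?_, ?_, ?_, ?_⟩, ?_⟩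
    · exact fun a b h => (h (Subsingleton.elim a b)).elim
    · exact fun a b h => (h (Subsingleton.elim a b)).elim
    · rintro i j ⟨l, hi, -⟩
      simp [Finset.mem_singleton.1 hi]
    · intro i j h
      refine if_neg fun hi => h ⟨0, ?_, Finset.mem_univ j⟩
      simp [hi]
    · intro i j
      by_cases h : i₀ = i <;> simp [hi₀, h]
  · ext i j
    simp only [Matrix.sum_apply, Matrix.of_apply]
    rw [(Fintype.equivFin m).symm.sum_comp fun k => if k = i then A i j else 0]
    simp

theorem isSpiky_zero {m n : Type*} : IsSpiky (0 : Matrix m n ℝ) :=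
  ⟨0, 0, 0, ⟨0, fun _ => ∅, fun _ => ∅, fun a => a.elim0, fun a => a.elim0,
    fun _ _ ⟨l, _⟩ => l.elim0, fun _ _ _ => rfl⟩, by simp⟩

theorem exists_isSpiky_of_signSpikyRank_le {m n : Type*} [Fintype m] [Fintype n]
    {M : Matrix m n ℝ} {r : ℕ} (h : signSpikyRank M ≤ r) :
    ∃ f : Fin r → Matrix m n ℝ, (∀ t, IsSpiky (f t)) ∧
      ∀ i j, Real.sign (∑ t, f t i j) = Real.sign (M i j) := by
  obtain ⟨A, hA, hAr⟩ := Nat.sInf_mem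
    (s := {r | ∃ A : Matrix m n ℝ,
      (∀ i j, Real.sign (A i j) = Real.sign (M i j)) ∧ spikyRank A ≤ r})
    ⟨spikyRank M, M, fun _ _ => rfl, le_rfl⟩
  obtain ⟨t, rfl⟩ := Nat.exists_eq_add_of_le (hAr.trans h)
  obtain ⟨f, hf, hfA⟩ := exists_isSpiky_sum_eq A
  refine ⟨Fin.append f fun _ => 0, fun i => ?_, fun i j => ?_⟩
  · induction i using Fin.addCases with
    | left i => simpa using hf i
    | right i => simpa using isSpiky_zero
  · rw [← hA i j, Fin.sum_univ_add]
    conv_rhs => rw [← hfA, Matrix.sum_apply]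
    simp

/-- The number of shapes, weighted by `D` to the number of free parameters. -/
theorem SpikyShape.sum_pow_card_var {m n : Type*} [Fintype m] [DecidableEq m] [Fintype n]
    [DecidableEq n] (D : ℕ) :
    ∑ p : SpikyShape m n, D ^ Fintype.card p.Var =
      ∑ R : Finset m, ((R.card + 1) * D) ^ (Fintype.card m - R.card + Fintype.card n) := by
  rw [Fintype.sum_sigma]
  refine Finset.sum_congr rfl fun R _ => ?_
  have : Fintype.card {i // i ∉ R} = Fintype.card m - R.card := by
    rw [Fintype.card_subtype_compl, Fintype.card_coe]
  simp only [Fintype.card_sum, this, Finset.sum_const, Finset.card_univ, Fintype.card_prod,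
    Fintype.card_fun, Fintype.card_option, Fintype.card_coe, smul_eq_mul]
  rw [mul_pow, pow_add (R.card + 1)]

/-- The number of sign matrices of sign spiky rank at most `r`. -/
theorem ncard_signSpikyRank_le {m n : Type*} [Fintype m] [DecidableEq m] [Fintype n]
    [DecidableEq n] (r : ℕ) :
    {b : Matrix m n Bool |
        signSpikyRank (Matrix.of fun i j => if b i j then (1 : ℝ) else -1) ≤ r}.ncard ≤
      2 * (∑ R : Finset m, ((R.card + 1) * (2 * (Fintype.card m * Fintype.card n) + 1)) ^
        (Fintype.card m - R.card + Fintype.card n)) ^ r := by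
  classical
  set D := 2 * (Fintype.card m * Fintype.card n) + 1 with hD
  let F (P : Fin r → SpikyShape m n) (q : m × n) : MvPolynomial (Σ t, (P t).Var) ℝ :=
    ∑ t, MvPolynomial.rename (Sigma.mk t) ((P t).entry q.1 q.2)
  let T (P : Fin r → SpikyShape m n) : Set (m × n → Bool) :=
    {s | ∃ x, ∀ q, 0 < (if s q then 1 else -1) * MvPolynomial.eval x (F P q)}
  have hT : ∀ P, (T P).ncard ≤ 2 * ∏ t, D ^ Fintype.card (P t).Var := by
    intro P
    have hdeg : ∀ q, (F P q).totalDegree ≤ 2 := fun q =>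
      MvPolynomial.totalDegree_finsetSum_le fun t _ =>
        (MvPolynomial.totalDegree_rename_le _ _).trans (SpikyShape.totalDegree_entry_le _ _ _)
    have hsum : ∑ q, (F P q).totalDegree ≤ 2 * (Fintype.card m * Fintype.card n) := by
      refine (Finset.sum_le_sum fun q _ => hdeg q).trans ?_
      simp [mul_comm]
    refine (MvPolynomial.ncard_signPatterns_le (F P)
      (K := Fintype.card m * Fintype.card n + 1) (by omega)).trans_eq ?_
    rw [Fintype.card_sigma, ← Finset.prod_pow_eq_pow_sum, hD]
    rfl
  have hsub : {b : Matrix m n Bool |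
      signSpikyRank (Matrix.of fun i j => if b i j then (1 : ℝ) else -1) ≤ r} ⊆
      ⋃ P, (Function.curry : (m × n → Bool) → Matrix m n Bool) '' T P := by
    intro b hb
    obtain ⟨f, hf, hsign⟩ := exists_isSpiky_of_signSpikyRank_le hb
    choose P x hx using fun t => SpikyShape.exists_eq_eval_entry (hf t)
    refine Set.mem_iUnion.2 ⟨P, fun q => b q.1 q.2, ⟨fun v => x v.1 v.2, fun q => ?_⟩, rfl⟩
    have h1 : MvPolynomial.eval (fun v : Σ t, (P t).Var => x v.1 v.2) (F P q) =
        ∑ t, f t q.1 q.2 := by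
      simp only [F, map_sum, MvPolynomial.eval_rename, hx]
      rfl
    have h2 := hsign q.1 q.2
    rw [h1]
    change 0 < (if b q.1 q.2 then (1 : ℝ) else -1) * ∑ t, f t q.1 q.2
    rw [Matrix.of_apply] at h2
    generalize ∑ t, f t q.1 q.2 = y at h2
    have hneg : Real.sign (-1) = -1 := Real.sign_of_neg (by norm_num)
    rcases lt_trichotomy y 0 with hy | rfl | hy
    · rw [Real.sign_of_neg hy] at h2
      split_ifs at h2 ⊢
      · norm_num at h2
      · linarith
    · split_ifs at h2 <;> norm_num [hneg] at h2
    · rw [Real.sign_of_pos hy] at h2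
      split_ifs at h2 ⊢
      · linarith
      · norm_num [hneg] at h2
  calc _ ≤ (⋃ P, (Function.curry : (m × n → Bool) → Matrix m n Bool) '' T P).ncard :=
        Set.ncard_le_ncard hsub (Set.toFinite _)
    _ ≤ ∑ P, ((Function.curry : (m × n → Bool) → Matrix m n Bool) '' T P).ncard :=
        by simpa using Finset.set_ncard_biUnion_le Finset.univ fun P =>
          (Function.curry : (m × n → Bool) → Matrix m n Bool) '' T P
    _ ≤ ∑ P : Fin r → SpikyShape m n, 2 * ∏ t, D ^ Fintype.card (P t).Var :=
        Finset.sum_le_sum fun P _ => (Set.ncard_image_le (Set.toFinite _)).trans (hT P)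
    _ = _ := by
        rw [← Finset.mul_sum, ← SpikyShape.sum_pow_card_var, Fintype.sum_pow]

theorem two_mul_sum_pow_le {N : ℕ} (hN : 32 ≤ N) :
    2 * ∑ R : Finset (Fin N), ((R.card + 1) * (2 * (N * N) + 1)) ^ (N - R.card + N) ≤
      N ^ (6 * N) := by
  have hN' : (32 : ℝ) ≤ N := by exact_mod_cast hN
  have hD : (2 * (N * N) + 1 : ℝ) ≤ 2.001 * N ^ 2 := by nlinarith
  have hsmall : ∀ a : ℝ, 0 ≤ a → a ≤ 0.7 → a ^ N ≤ 1 / 2 := fun a h0 h1 =>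
    (pow_le_pow_of_le_one h0 (by linarith) (by omega : 2 ≤ N)).trans (by nlinarith)
  have key : ∀ R : Finset (Fin N),
      2 ^ N * (((R.card + 1) * (2 * (N * N) + 1) : ℝ)) ^ (N - R.card + N) ≤
        1 / 2 * (N : ℝ) ^ (6 * N) := by
    intro R
    have hRN : R.card ≤ N := by simpa using R.card_le_univ
    set k := R.card
    have hkN : (k : ℝ) ≤ N := by exact_mod_cast hRN
    rcases lt_or_ge (4 * k) N with hk | hk
    · have hk' : (4 * k : ℝ) ≤ N := by exact_mod_cast hk.le
      have hb : ((k + 1) * (2 * (N * N) + 1) : ℝ) ≤ 0.57 * N ^ 3 :=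
        calc ((k + 1) * (2 * (N * N) + 1) : ℝ) ≤ (9 / 32 * N) * (2.001 * N ^ 2) := by
              gcongr
              linarith
          _ ≤ _ := by
              have : (0 : ℝ) ≤ N ^ 3 := by positivity
              nlinarith
      have h1 : (1 : ℝ) ≤ 0.57 * N ^ 3 := by
        have : (32 : ℝ) ^ 3 ≤ N ^ 3 := by gcongr
        linarith
      calc 2 ^ N * (((k + 1) * (2 * (N * N) + 1) : ℝ)) ^ (N - k + N)
          ≤ 2 ^ N * (0.57 * N ^ 3 : ℝ) ^ (N - k + N) := by gcongr
        _ ≤ 2 ^ N * (0.57 * N ^ 3 : ℝ) ^ (2 * N) := by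
            gcongr 2 ^ N * ?_
            exact pow_le_pow_right₀ h1 (by omega)
        _ = (2 * 0.57 ^ 2 : ℝ) ^ N * N ^ (6 * N) := by
            rw [show 6 * N = 3 * (2 * N) by ring, pow_mul (N : ℝ) 3, mul_pow, mul_pow, ← pow_mul,
              ← pow_mul]
            ring
        _ ≤ _ := by
            gcongr
            exact hsmall _ (by norm_num) (by norm_num)
    · have hb : ((k + 1) * (2 * (N * N) + 1) : ℝ) ≤ 2.1 * N ^ 3 :=
        calc ((k + 1) * (2 * (N * N) + 1) : ℝ) ≤ (33 / 32 * N) * (2.001 * N ^ 2) := by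
              gcongr
              linarith
          _ ≤ _ := by
              have : (0 : ℝ) ≤ N ^ 3 := by positivity
              nlinarith
      have h1 : (2 : ℝ) ^ 16 ≤ 2.1 * N ^ 3 := by
        have : (32 : ℝ) ^ 3 ≤ N ^ 3 := by gcongr
        linarith
      have h2 : (16 : ℝ) ^ N ≤ (2.1 * N ^ 3 : ℝ) ^ k :=
        calc (16 : ℝ) ^ N ≤ 16 ^ (4 * k) := pow_le_pow_right₀ (by norm_num) hk
          _ = (2 ^ 16) ^ k := by rw [pow_mul]; norm_num
          _ ≤ _ := by gcongr
      have h3 : (16 : ℝ) ^ N * (2 ^ N * (2.1 * N ^ 3 : ℝ) ^ (N - k + N)) ≤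
          16 ^ N * (1 / 2 * (N : ℝ) ^ (6 * N)) :=
        calc (16 : ℝ) ^ N * (2 ^ N * (2.1 * N ^ 3 : ℝ) ^ (N - k + N))
            ≤ (2.1 * N ^ 3 : ℝ) ^ k * (2 ^ N * (2.1 * N ^ 3 : ℝ) ^ (N - k + N)) := by gcongr
          _ = 2 ^ N * (2.1 * N ^ 3 : ℝ) ^ (2 * N) := by
              rw [mul_left_comm, ← pow_add]
              congr 2
              omega
          _ = 16 ^ N * ((2 * 2.1 ^ 2 / 16 : ℝ) ^ N * N ^ (6 * N)) := by
              rw [show 6 * N = 3 * (2 * N) by ring, pow_mul (N : ℝ) 3, mul_pow, div_pow, mul_pow,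
                ← pow_mul, ← pow_mul]
              field_simp
          _ ≤ _ := by
              gcongr
              exact hsmall _ (by norm_num) (by norm_num)
      have h4 := le_of_mul_le_mul_left h3 (by positivity)
      exact le_trans (by gcongr) h4
  have hsum : (2 : ℝ) ^ N * ∑ R : Finset (Fin N),
      ((R.card + 1) * (2 * (N * N) + 1) : ℝ) ^ (N - R.card + N) ≤
        2 ^ N * (1 / 2 * (N : ℝ) ^ (6 * N)) := by
    rw [Finset.mul_sum]
    refine (Finset.sum_le_sum fun R _ => key R).trans_eq ?_
    simp
  have := le_of_mul_le_mul_left hsum (by positivity)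
  have h : (2 * ∑ R : Finset (Fin N),
      ((R.card + 1) * (2 * (N * N) + 1) : ℝ) ^ (N - R.card + N)) ≤ N ^ (6 * N) := by linarith
  exact_mod_cast h

/-- A uniformly random ±1 matrix has sign spiky rank at least N/(12 log₂ N)
with probability at least 1 - 2^(-N²/2). -/
theorem random_sign_matrix_high_signSpikyRank (N : ℕ) :
    (1 - (2 : ℝ) ^ (-(N ^ 2 : ℝ) / 2)) * 2 ^ (N ^ 2) ≤
      ({b : Matrix (Fin N) (Fin N) Bool |
        (N : ℝ) / (12 * Real.logb 2 N) ≤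
          (signSpikyRank (Matrix.of fun i j => if b i j then (1 : ℝ) else -1) : ℝ)}.ncard : ℝ) := by
  classical
  set B : ℝ := (N : ℝ) / (12 * Real.logb 2 N) with hB
  let rk (b : Matrix (Fin N) (Fin N) Bool) : ℕ :=
    signSpikyRank (Matrix.of fun i j => if b i j then (1 : ℝ) else -1)
  have hcompl : ({b | B ≤ (rk b : ℝ)} : Set (Matrix (Fin N) (Fin N) Bool)).ncard +
      ({b | B ≤ (rk b : ℝ)}ᶜ : Set (Matrix (Fin N) (Fin N) Bool)).ncard = 2 ^ (N ^ 2) := by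
    rw [Set.ncard_add_ncard_compl, Nat.card_eq_fintype_card]
    change Fintype.card (Fin N → Fin N → Bool) = _
    simp [← pow_mul, sq]
  suffices hbad : (({b | B ≤ (rk b : ℝ)}ᶜ : Set (Matrix (Fin N) (Fin N) Bool)).ncard : ℝ) ≤
      (2 : ℝ) ^ ((N ^ 2 : ℝ) / 2) by
    have h1 : (2 : ℝ) ^ (-(N ^ 2 : ℝ) / 2) * 2 ^ (N ^ 2) = (2 : ℝ) ^ ((N ^ 2 : ℝ) / 2) := by
      rw [← Real.rpow_natCast 2 (N ^ 2), ← Real.rpow_add two_pos]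
      push_cast
      ring_nf
    have h2 : (({b | B ≤ (rk b : ℝ)} : Set (Matrix (Fin N) (Fin N) Bool)).ncard : ℝ) +
        ({b | B ≤ (rk b : ℝ)}ᶜ : Set (Matrix (Fin N) (Fin N) Bool)).ncard = 2 ^ (N ^ 2) := by
      exact_mod_cast hcompl
    rw [sub_mul, one_mul, h1]
    change _ ≤ (({b | B ≤ (rk b : ℝ)} : Set (Matrix (Fin N) (Fin N) Bool)).ncard : ℝ)
    linarith
  rcases Set.eq_empty_or_nonempty
    ({b | B ≤ (rk b : ℝ)}ᶜ : Set (Matrix (Fin N) (Fin N) Bool)) with he | ⟨b₀, hb₀⟩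
  · rw [he, Set.ncard_empty, Nat.cast_zero]
    positivity
  replace hb₀ : (rk b₀ : ℝ) < B := not_le.1 hb₀
  have hBpos : 0 < B := (Nat.cast_nonneg _).trans_lt hb₀
  have hN2 : 2 ≤ N := by
    by_contra h
    have : N = 0 ∨ N = 1 := by omega
    rcases this with rfl | rfl <;> simp [hB] at hBpos
  have hlog : 0 < Real.logb 2 N := Real.logb_pos one_lt_two (by exact_mod_cast hN2)
  have hrk : 1 ≤ rk b₀ := by
    by_contra h
    obtain ⟨f, -, hf⟩ := exists_isSpiky_of_signSpikyRank_le (r := 0)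
      (M := Matrix.of fun i j => if b₀ i j then (1 : ℝ) else -1) (by change rk b₀ ≤ 0; omega)
    have h0 := hf ⟨0, by omega⟩ ⟨0, by omega⟩
    rw [Finset.univ_eq_empty, Finset.sum_empty, Real.sign_zero, eq_comm,
      Real.sign_eq_zero_iff, Matrix.of_apply] at h0
    split_ifs at h0 <;> norm_num at h0
  have hN32 : 32 ≤ N := by
    by_contra! h
    have h1 : (12 * Real.logb 2 N) < N := by
      have : 1 < B := lt_of_le_of_lt (by exact_mod_cast hrk) hb₀
      rwa [hB, one_lt_div (by positivity)] at this
    have hle : ∀ j : ℕ, 2 ^ j ≤ N → 12 * j < N := by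
      intro j hj
      have : (j : ℝ) ≤ Real.logb 2 N := by
        rw [Real.le_logb_iff_rpow_le one_lt_two (by positivity), Real.rpow_natCast]
        exact_mod_cast hj
      have h2 : (12 * j : ℝ) < N := by linarith
      exact_mod_cast h2
    have := hle 1
    have := hle 2
    have := hle 3
    have := hle 4
    omega
  obtain ⟨r, hr⟩ : ∃ r, ⌈B⌉₊ = r + 1 :=
    Nat.exists_eq_succ_of_ne_zero (Nat.ceil_pos.2 hBpos).ne'
  have hrB : ∀ s : ℕ, s ≤ r ↔ (s : ℝ) < B := fun s => by
    rw [← Nat.lt_ceil, hr, Nat.lt_succ_iff]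
  have hr1 : r ≠ 0 := Nat.one_le_iff_ne_zero.1 (hrk.trans ((hrB _).2 hb₀))
  have hcount : ({b | B ≤ (rk b : ℝ)}ᶜ : Set (Matrix (Fin N) (Fin N) Bool)).ncard ≤
      N ^ (6 * N * r) := by
    have hsub : ({b | B ≤ (rk b : ℝ)}ᶜ : Set (Matrix (Fin N) (Fin N) Bool)) ⊆
        {b | rk b ≤ r} := fun b hb => (hrB _).2 (not_le.1 hb)
    refine (Set.ncard_le_ncard hsub (Set.toFinite _)).trans
      ((ncard_signSpikyRank_le r).trans ?_)
    simp only [Fintype.card_fin]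
    calc _ ≤ (2 * ∑ R : Finset (Fin N),
            ((R.card + 1) * (2 * (N * N) + 1)) ^ (N - R.card + N)) ^ r := by
          rw [mul_pow]
          exact Nat.mul_le_mul_right _ (Nat.le_self_pow hr1 2)
      _ ≤ _ := by
          rw [pow_mul]
          exact Nat.pow_le_pow_left (two_mul_sum_pow_le hN32) r
  calc (({b | B ≤ (rk b : ℝ)}ᶜ : Set (Matrix (Fin N) (Fin N) Bool)).ncard : ℝ)
      ≤ (N : ℝ) ^ (6 * N * r) := by exact_mod_cast hcount
    _ = (2 : ℝ) ^ (Real.logb 2 N * (6 * N * r : ℕ)) := by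
        rw [Real.rpow_mul two_pos.le, Real.rpow_logb two_pos (by norm_num) (by positivity),
          Real.rpow_natCast]
    _ ≤ _ := by
        refine Real.rpow_le_rpow_of_exponent_le one_le_two ?_
        have h1 : (r : ℝ) * (12 * Real.logb 2 N) ≤ N := by
          rw [← le_div_iff₀ (by positivity)]
          exact ((hrB r).1 le_rfl).le
        have h2 := mul_le_mul_of_nonneg_left h1 (Nat.cast_nonneg N : (0 : ℝ) ≤ N)
        push_cast
        nlinarith
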